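/- arXiv:1305.3035 — 2 statements merged into one kernel-verified Lean document; each statement's English description precedes it below -/
import Mathlib

section
/- Let d ≥ 2 and M, k ≥ 1 be integers, and let f be chosen uniformly at random from L_M(d,k). Then for every integer t ≥ 1, Pr(f(v_0) = M + t) ≤ (9/10)^(d^⌊(t-1)/M⌋) · Pr(f(v_0) = 0). -/
/-- The vertices of the rooted `d`-ary tree of depth `k`: sequences over `Fin d`
of length at most `k`.  The root is the empty sequence, the children of a vertex
`l` with `l.length < k` are the vertices `l ++ [j]` for `j : Fin d`, and the
leaves are the vertices of length exactly `k`. -/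
abbrev Vtx (d k : ℕ) : Type := {l : List (Fin d) // l.length ≤ k}

/-- The root `v₀` of the tree. -/
def rootV (d k : ℕ) : Vtx d k := ⟨[], by simp⟩

/-- `L_M(d,k)`: the set of integer-valued `M`-Lipschitz functions on the
`d`-ary tree of depth `k` that vanish on all leaves. -/
def LM (d k M : ℕ) : Set (Vtx d k → ℤ) :=
  {f | (∀ v : Vtx d k, v.1.length = k → f v = 0) ∧
       (∀ (l : List (Fin d)) (hl : l.length + 1 ≤ k) (j : Fin d),
         |f ⟨l ++ [j], by simpa using hl⟩ - f ⟨l, Nat.le_of_succ_le hl⟩| ≤ (M : ℤ))}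

/-- `G(t,k)`: the number of functions in `L_M(d,k)` whose value at the root is `t`. -/
noncomputable def G (d k M : ℕ) (t : ℤ) : ℕ :=
  Nat.card {f : Vtx d k → ℤ // f ∈ LM d k M ∧ f (rootV d k) = t}

/-- The probability that a uniformly random element of `L_M(d,k)` takes the
value `t` at the root. -/
noncomputable def PrRoot (d k M : ℕ) (t : ℤ) : ℝ :=
  (G d k M t : ℝ) / (Nat.card (LM d k M) : ℝ)

/-- The sum of `g` over the window of radius `m` centred at `t`. -/
noncomputable def windowSum (m : ℤ) (g : ℤ → ℝ) (t : ℤ) : ℝ :=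
  ∑ i ∈ Finset.Icc (t - m) (t + m), g i

/-- Even, nonnegative, log-concave functions on `ℤ` that are positive at the origin. -/
structure EvenLogConcave (g : ℤ → ℝ) : Prop where
  nonneg : ∀ t, 0 ≤ g t
  pos : 0 < g 0
  even : ∀ t, g (-t) = g t
  logConcave : ∀ x y a : ℤ, x ≤ y → 0 ≤ a → g x * g (y + a) ≤ g y * g (x + a)

theorem sum_Icc_split (g : ℤ → ℝ) {p q r : ℤ} (hp : p ≤ r + 1) (hq : r ≤ q) :
    ∑ i ∈ Finset.Icc p q, g i =
      ∑ i ∈ Finset.Icc p r, g i + ∑ i ∈ Finset.Icc (r + 1) q, g i := by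
  rw [← Finset.sum_union]
  · congr 1
    ext i
    simp only [Finset.mem_union, Finset.mem_Icc]
    omega
  · rw [Finset.disjoint_left]
    intro i
    simp only [Finset.mem_Icc]
    omega

theorem sum_Icc_shift (g : ℤ → ℝ) (p q a : ℤ) :
    ∑ i ∈ Finset.Icc (a + p) (a + q), g i = ∑ i ∈ Finset.Icc p q, g (a + i) := by
  refine Finset.sum_nbij' (fun i => i - a) (fun i => a + i) ?_ ?_ ?_ ?_ ?_ <;>
    intro i <;> simp only [Finset.mem_Icc] <;> intros
  · omega
  · omega
  · omega
  · omega
  · congr 1; omega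

theorem sum_Icc_neg {g : ℤ → ℝ} (hg : ∀ t, g (-t) = g t) (p q : ℤ) :
    ∑ i ∈ Finset.Icc (-q) (-p), g i = ∑ i ∈ Finset.Icc p q, g i := by
  refine Finset.sum_nbij' (fun i => -i) (fun i => -i) ?_ ?_ ?_ ?_ ?_ <;>
    intro i <;> simp only [Finset.mem_Icc] <;> intros
  · omega
  · omega
  · omega
  · omega
  · exact (hg i).symm

theorem sum_Icc_mul_indicator (g : ℤ → ℝ) {p q u v : ℤ} (z : ℤ) (hp : p ≤ u) (hq : v ≤ q) :
    ∑ s ∈ Finset.Icc p q, g (z - s) * (if u ≤ s ∧ s ≤ v then 1 else 0) =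
      ∑ i ∈ Finset.Icc (z - v) (z - u), g i := by
  simp only [mul_ite, mul_one, mul_zero]
  rw [← Finset.sum_filter]
  refine Finset.sum_nbij' (fun i => z - i) (fun i => z - i) ?_ ?_ ?_ ?_ ?_ <;>
    intro i <;> simp only [Finset.mem_Icc, Finset.mem_filter] <;> intros
  all_goals first | trivial | omega

theorem sum_mul_sum_le_of_minors_nonneg (I : Finset ℤ) (A B C D : ℤ → ℝ)
    (hAC : ∀ s t, s ≤ t → A t * C s ≤ A s * C t)
    (hBD : ∀ s t, s ≤ t → B t * D s ≤ B s * D t) :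
    (∑ s ∈ I, A s * D s) * (∑ s ∈ I, C s * B s) ≤
      (∑ s ∈ I, A s * B s) * (∑ s ∈ I, C s * D s) := by
  have key : 0 ≤ ∑ s ∈ I, ∑ t ∈ I, (A s * C t - A t * C s) * (B s * D t - B t * D s) := by
    refine Finset.sum_nonneg fun s _ => Finset.sum_nonneg fun t _ => ?_
    rcases le_total s t with h | h
    · exact mul_nonneg (sub_nonneg.2 (hAC s t h)) (sub_nonneg.2 (hBD s t h))
    · exact mul_nonneg_of_nonpos_of_nonpos (by linarith [hAC t s h]) (by linarith [hBD t s h])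
  have expand : ∑ s ∈ I, ∑ t ∈ I, (A s * C t - A t * C s) * (B s * D t - B t * D s) =
      2 * ((∑ s ∈ I, A s * B s) * (∑ s ∈ I, C s * D s) -
        (∑ s ∈ I, A s * D s) * (∑ s ∈ I, C s * B s)) := by
    have h1 : ∑ s ∈ I, ∑ t ∈ I, (A s * C t - A t * C s) * (B s * D t - B t * D s) =
        ∑ s ∈ I, ∑ t ∈ I, ((A s * B s) * (C t * D t) - (A s * D s) * (C t * B t)
          - (C s * B s) * (A t * D t) + (C s * D s) * (A t * B t)) :=
      Finset.sum_congr rfl fun s _ => Finset.sum_congr rfl fun t _ => by ring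
    rw [h1]
    simp only [Finset.sum_add_distrib, Finset.sum_sub_distrib, ← Finset.sum_mul_sum]
    ring
  linarith

theorem windowSum_logConcave {m : ℤ} {g : ℤ → ℝ}
    (hg : ∀ x y a : ℤ, x ≤ y → 0 ≤ a → g x * g (y + a) ≤ g y * g (x + a))
    (x y a : ℤ) (hxy : x ≤ y) (ha : 0 ≤ a) :
    windowSum m g x * windowSum m g (y + a) ≤ windowSum m g y * windowSum m g (x + a) := by
  have h := sum_mul_sum_le_of_minors_nonneg (Finset.Icc (-m) (m + a))
    (fun s => g (x + a - s)) (fun s => if -m ≤ s ∧ s ≤ m then 1 else 0)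
    (fun s => g (y + a - s)) (fun s => if -m + a ≤ s ∧ s ≤ m + a then 1 else 0) ?_ ?_
  · rw [sum_Icc_mul_indicator, sum_Icc_mul_indicator, sum_Icc_mul_indicator,
      sum_Icc_mul_indicator] at h <;> try omega
    have e : ∀ z b : ℤ, ∑ i ∈ Finset.Icc (z + b - (m + b)) (z + b - (-m + b)), g i
        = windowSum m g z := fun z b => by unfold windowSum; congr 2 <;> ring
    have e' : ∀ z : ℤ, ∑ i ∈ Finset.Icc (z - m) (z - -m), g i = windowSum m g z :=
      fun z => by unfold windowSum; congr 2; ring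
    rw [e, e, e', e'] at h
    linarith
  · intro s t hst
    have := hg (x + a - t) (y + a - t) (t - s) (by omega) (by omega)
    rw [show y + a - t + (t - s) = y + a - s by ring,
      show x + a - t + (t - s) = x + a - s by ring] at this
    linarith
  · intro s t hst
    split_ifs <;> first | omega | norm_num

namespace EvenLogConcave

variable {g : ℤ → ℝ}

theorem antitone (hg : EvenLogConcave g) {x y : ℤ} (hx : 0 ≤ x) (hxy : x ≤ y) : g y ≤ g x := by
  have h := hg.logConcave (-y) x (y - x) (by omega) (by omega)
  rw [show x + (y - x) = y by ring, show -y + (y - x) = -x by ring, hg.even, hg.even] at h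
  exact (mul_self_le_mul_self_iff (hg.nonneg y) (hg.nonneg x)).2 h

theorem sum_nonneg (hg : EvenLogConcave g) (I : Finset ℤ) : 0 ≤ ∑ i ∈ I, g i :=
  Finset.sum_nonneg fun i _ => hg.nonneg i

theorem windowSum (hg : EvenLogConcave g) {m : ℤ} (hm : 0 ≤ m) :
    EvenLogConcave (windowSum m g) where
  nonneg _ := hg.sum_nonneg _
  pos := lt_of_lt_of_le hg.pos
    (Finset.single_le_sum (f := g) (fun i _ => hg.nonneg i) (Finset.mem_Icc.2 (by omega)))
  even t := by
    unfold _root_.windowSum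
    rw [← sum_Icc_neg hg.even]
    congr 2 <;> ring
  logConcave := windowSum_logConcave hg.logConcave

theorem pow (hg : EvenLogConcave g) (d : ℕ) : EvenLogConcave (fun t => g t ^ d) where
  nonneg t := pow_nonneg (hg.nonneg t) d
  pos := pow_pos hg.pos d
  even t := by rw [hg.even]
  logConcave x y a hxy ha := by
    rw [← mul_pow, ← mul_pow]
    exact pow_le_pow_left₀ (mul_nonneg (hg.nonneg _) (hg.nonneg _))
      (hg.logConcave x y a hxy ha) d

/-- The decay ratio across a gap `a` does not increase when moving away from the origin. -/
theorem ratio_le (hg : EvenLogConcave g) {x y a : ℤ} {ρ : ℝ} (hxy : x ≤ y) (ha : 0 ≤ a)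
    (hx : 0 < g x) (h : g (a + x) ≤ ρ * g x) : g (a + y) ≤ ρ * g y := by
  have h1 := hg.logConcave x y a hxy ha
  rw [add_comm y, add_comm x] at h1
  have h2 := mul_le_mul_of_nonneg_left h (hg.nonneg y)
  refine le_of_mul_le_mul_left ?_ hx
  linarith

theorem sum_shift_le (hg : EvenLogConcave g) {p q a : ℤ} {ρ : ℝ} (ha : 0 ≤ a)
    (hpos : 0 < g p) (h : g (a + p) ≤ ρ * g p) :
    ∑ i ∈ Finset.Icc (a + p) (a + q), g i ≤ ρ * ∑ i ∈ Finset.Icc p q, g i := by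
  rw [sum_Icc_shift, Finset.mul_sum]
  exact Finset.sum_le_sum fun i hi => hg.ratio_le (Finset.mem_Icc.1 hi).1 ha hpos h

/-- A decay bound at distance `a` for `g` passes to distance `a + m` for the window sums. -/
theorem windowSum_add_le (hg : EvenLogConcave g) {m a : ℤ} {ρ : ℝ} (hm : 0 ≤ m) (ha : 0 ≤ a)
    (hρ : 0 ≤ ρ) (h : g a ≤ ρ * g 0) :
    _root_.windowSum m g (a + m) ≤ ρ * _root_.windowSum m g 0 := by
  have h1 := hg.sum_shift_le (q := m + m) ha hg.pos (by simpa using h)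
  have h2 := (hg.windowSum hm).antitone le_rfl hm
  calc _root_.windowSum m g (a + m)
      = ∑ i ∈ Finset.Icc (a + 0) (a + (m + m)), g i := by
        unfold _root_.windowSum; congr 2 <;> ring
    _ ≤ ρ * _root_.windowSum m g m := by
        convert h1 using 2
        unfold _root_.windowSum; congr 2; ring
    _ ≤ _ := mul_le_mul_of_nonneg_left h2 hρ

theorem windowSum_eq (hg : EvenLogConcave g) {m j : ℤ} (hj : 0 ≤ j) (hjm : j ≤ m) :
    _root_.windowSum m g j =
      ∑ i ∈ Finset.Icc 1 (m - j), g i + ∑ i ∈ Finset.Icc 0 (m + j), g i := by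
  unfold _root_.windowSum
  rw [sum_Icc_split g (r := -1) (by omega) (by omega), ← sum_Icc_neg hg.even 1 (m - j)]
  congr 3 <;> ring

theorem sum_Icc_le_sum_Icc_sub (hg : EvenLogConcave g) {p q b : ℤ} (hp : b ≤ p) (hb : 0 ≤ b) :
    ∑ i ∈ Finset.Icc p q, g i ≤ ∑ i ∈ Finset.Icc (p - b) (q - b), g i := by
  have e : ∑ i ∈ Finset.Icc p q, g i = ∑ i ∈ Finset.Icc (p - b) (q - b), g (b + i) := by
    rw [← sum_Icc_shift]; congr 2 <;> ring
  rw [e]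
  refine Finset.sum_le_sum fun i hi => ?_
  rw [Finset.mem_Icc] at hi
  exact hg.antitone (by omega) (by omega)

theorem windowSum_succ_add_le (hg : EvenLogConcave g) {m j : ℤ} {ρ : ℝ} (hj : 0 ≤ j)
    (hjm : j ≤ m) (h : g (m + 1) ≤ ρ * g 0) :
    _root_.windowSum m g (m + 1 + j) ≤
      ∑ i ∈ Finset.Icc 1 (m - j), g i + ρ * ∑ i ∈ Finset.Icc 0 (m + j), g i := by
  have h1 := hg.sum_shift_le (a := m + 1) (q := m + j) (by omega) hg.pos (by simpa using h)
  have h2 := hg.sum_Icc_le_sum_Icc_sub (p := j + 1) (q := m) (b := j) (by omega) hj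
  rw [show j + 1 - j = 1 by ring] at h2
  have h3 : _root_.windowSum m g (m + 1 + j) = ∑ i ∈ Finset.Icc (j + 1) m, g i +
      ∑ i ∈ Finset.Icc (m + 1 + 0) (m + 1 + (m + j)), g i := by
    unfold _root_.windowSum
    rw [sum_Icc_split g (r := m) (by omega) (by omega)]
    congr 3 <;> ring
  linarith

theorem sum_Icc_one_le (hg : EvenLogConcave g) {m : ℤ} (hm : 0 ≤ m) :
    ∑ i ∈ Finset.Icc 1 m, g i ≤ ∑ i ∈ Finset.Icc 0 m, g i := by
  rw [sum_Icc_split g (p := 0) (r := 0) (by omega) hm]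
  simpa using hg.nonneg 0

theorem windowSum_pow_le (hg : EvenLogConcave g) {m x y : ℤ} {σ : ℝ} {d : ℕ} (hd : 2 ≤ d)
    (hm : 0 ≤ m) (hσ : 0 ≤ σ) (hσ1 : σ ≤ 1)
    (h : _root_.windowSum m g x ≤ σ * _root_.windowSum m g y) :
    _root_.windowSum m g x ^ d ≤ σ ^ 2 * _root_.windowSum m g y ^ d := by
  have hW := hg.windowSum hm
  calc _ ≤ (σ * _root_.windowSum m g y) ^ d := pow_le_pow_left₀ (hW.nonneg x) h d
    _ = σ ^ d * _root_.windowSum m g y ^ d := mul_pow _ _ _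
    _ ≤ _ := mul_le_mul_of_nonneg_right (pow_le_pow_of_le_one hσ hσ1 hd)
      (pow_nonneg (hW.nonneg y) d)

theorem windowSum_pow_succ_le (hg : EvenLogConcave g) {m : ℤ} {ρ : ℝ} {d : ℕ} (hd : 2 ≤ d)
    (hm : 0 ≤ m) (hρ : 0 ≤ ρ) (hρ1 : ρ ≤ 1) (h : g (m + 1) ≤ ρ * g 0) :
    _root_.windowSum m g (m + 1) ^ d ≤ ((1 + ρ) / 2) ^ 2 * _root_.windowSum m g 0 ^ d := by
  refine hg.windowSum_pow_le hd hm (by linarith) (by linarith) ?_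
  have h1 := hg.windowSum_succ_add_le le_rfl hm h
  have h2 := hg.windowSum_eq le_rfl hm
  have h3 := hg.sum_Icc_one_le hm
  rw [add_zero] at h1
  rw [h2]
  simp only [sub_zero, add_zero] at h1 ⊢
  nlinarith

theorem sum_Icc_le_card (hg : EvenLogConcave g) {p q : ℤ} (hp : 0 ≤ p) (hpq : p ≤ q + 1) :
    ∑ i ∈ Finset.Icc p q, g i ≤ ((q - p + 1 : ℤ) : ℝ) * g 0 := by
  have h := Finset.sum_le_card_nsmul (Finset.Icc p q) g (g 0) fun i hi =>
    hg.antitone le_rfl (hp.trans (Finset.mem_Icc.1 hi).1)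
  rw [nsmul_eq_mul, Int.card_Icc] at h
  rwa [← Int.cast_natCast, Int.toNat_of_nonneg (by omega),
    show q + 1 - p = q - p + 1 by ring] at h

theorem card_mul_le_sum_Icc (hg : EvenLogConcave g) {p q : ℤ} {c : ℝ} (hp : 0 ≤ p)
    (hpq : p ≤ q + 1) (h : c ≤ g (q + 1)) :
    ((q - p + 1 : ℤ) : ℝ) * c ≤ ∑ i ∈ Finset.Icc p q, g i := by
  have h := Finset.card_nsmul_le_sum (Finset.Icc p q) g c fun i hi =>
    h.trans (hg.antitone (hp.trans (Finset.mem_Icc.1 hi).1)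
      (by linarith [(Finset.mem_Icc.1 hi).2]))
  rw [nsmul_eq_mul, Int.card_Icc] at h
  rwa [← Int.cast_natCast, Int.toNat_of_nonneg (by omega),
    show q + 1 - p = q - p + 1 by ring] at h

/-- When `g` is nearly flat on `[0, m + 1]`, the next function decays faster from the middle of
that interval than it does from the origin. -/
theorem windowSum_pow_middle_le (hg : EvenLogConcave g) {m j : ℤ} {d : ℕ} (hd : 2 ≤ d)
    (hj : 0 ≤ j) (hjm : j ≤ m) (hj2 : m ≤ 2 * j) (h : g (m + 1) ≤ 9 / 10 * g 0)
    (hflat : 89 / 100 * g 0 ≤ g (m + 1)) :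
    _root_.windowSum m g (m + 1 + j) ^ d ≤ 88 / 100 * _root_.windowSum m g j ^ d := by
  have hm : 0 ≤ m := hj.trans hjm
  have h1 := hg.windowSum_succ_add_le hj hjm h
  have h2 := hg.windowSum_eq hj hjm
  have h3 := hg.sum_Icc_le_card (p := 1) (q := m - j) (by omega) (by omega)
  have h4 := hg.card_mul_le_sum_Icc (p := 0) (q := m) le_rfl (by omega) hflat
  have h5 : ∑ i ∈ Finset.Icc 0 m, g i ≤ ∑ i ∈ Finset.Icc 0 (m + j), g i :=
    Finset.sum_le_sum_of_subset_of_nonneg (Finset.Icc_subset_Icc_right (by omega))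
      fun i _ _ => hg.nonneg i
  have h6 : (2 : ℝ) * ((m - j - 1 + 1 : ℤ) : ℝ) ≤ ((m - 0 + 1 : ℤ) : ℝ) := by
    exact_mod_cast (by omega : 2 * (m - j - 1 + 1) ≤ m - 0 + 1)
  have h7 := mul_le_mul_of_nonneg_right h6 hg.pos.le
  have h8 := hg.sum_nonneg (Finset.Icc 0 m)
  have hσ := hg.windowSum_pow_le (x := m + 1 + j) (y := j) (σ := 937 / 1000) hd hm
    (by norm_num) (by norm_num) (by linarith)
  have := pow_nonneg ((hg.windowSum hm).nonneg j) d
  linarith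

theorem windowSum_pow_succ_le_of_middle (hg : EvenLogConcave g) {m j : ℤ} {d : ℕ} (hd : 2 ≤ d)
    (hj : 1 ≤ j) (hj2 : 2 * j ≤ m + 1) (h : g (m + 1) ≤ 9 / 10 * g 0)
    (hflat : 89 / 100 * g 0 ≤ g (m + 1)) (hmid : g (m + 1 + j) ≤ 88 / 100 * g j) :
    _root_.windowSum m g (m + 1) ^ d ≤ 9 / 10 * _root_.windowSum m g 0 ^ d := by
  have hm : 0 ≤ m := by omega
  have hgpos := hg.pos
  have hposj : 0 < g j := by
    have := hg.antitone (x := j) (y := m + 1) (by omega) (by omega)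
    linarith
  have h0 := hg.windowSum_eq le_rfl hm
  simp only [sub_zero, add_zero] at h0
  have hs := sum_Icc_split g (p := 0) (r := j - 1) (q := m) (by omega) (by omega)
  rw [sub_add_cancel] at hs
  have h1 := hg.sum_shift_le (a := m + 1) (q := j - 1) (by omega) hg.pos (by simpa using h)
  have h2 := hg.sum_shift_le (a := m + 1) (q := m) (by omega) hposj hmid
  have h3 : _root_.windowSum m g (m + 1) = ∑ i ∈ Finset.Icc 1 m, g i +
      (∑ i ∈ Finset.Icc (m + 1 + 0) (m + 1 + (j - 1)), g i +
        ∑ i ∈ Finset.Icc (m + 1 + j) (m + 1 + m), g i) := by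
    unfold _root_.windowSum
    rw [sum_Icc_split g (r := m) (by omega) (by omega),
      sum_Icc_split g (p := m + 1) (r := m + j) (by omega) (by omega)]
    congr 4 <;> ring
  have h4 := hg.sum_Icc_le_card (p := 0) (q := j - 1) le_rfl (by omega)
  have h5 := hg.card_mul_le_sum_Icc (p := j) (q := m) (by omega) (by omega) hflat
  have h6 : ((j - 1 - 0 + 1 : ℤ) : ℝ) ≤ ((m - j + 1 : ℤ) : ℝ) := by
    exact_mod_cast (by omega : j - 1 - 0 + 1 ≤ m - j + 1)
  have h7 := mul_le_mul_of_nonneg_right h6 hg.pos.le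
  have h8 := hg.sum_Icc_one_le hm
  have h9 := hg.sum_nonneg (Finset.Icc 0 (j - 1))
  have hσ := hg.windowSum_pow_le (x := m + 1) (y := 0) (σ := 9486 / 10000) hd hm
    (by norm_num) (by norm_num) (by linarith)
  have := pow_nonneg ((hg.windowSum hm).nonneg 0) d
  linarith

end EvenLogConcave

/-- The recursion satisfied by the number of `m`-Lipschitz functions on the `d`-ary tree with
prescribed root value. -/
noncomputable def rootCount (d : ℕ) (m : ℤ) : ℕ → ℤ → ℝ
  | 0 => fun t => if t = 0 then 1 else 0
  | k + 1 => fun t => windowSum m (rootCount d m k) t ^ d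

theorem rootCount_evenLogConcave (d : ℕ) {m : ℤ} (hm : 0 ≤ m) (k : ℕ) :
    EvenLogConcave (rootCount d m k) := by
  induction k with
  | zero =>
    refine ⟨fun t => ?_, ?_, fun t => ?_, fun x y a hxy ha => ?_⟩ <;> simp only [rootCount]
    · split_ifs <;> norm_num
    · norm_num
    · simp
    · split_ifs <;> first | omega | norm_num
  | succ k ih => exact (ih.windowSum hm).pow d

theorem rootCount_succ_le {d : ℕ} {m : ℤ} (hd : 2 ≤ d) (hm : 1 ≤ m) (k : ℕ) :
    rootCount d m k (m + 1) ≤ 9 / 10 * rootCount d m k 0 := by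
  have hm0 : 0 ≤ m := by omega
  have hbase : rootCount d m 0 (m + 1) = 0 := if_neg (by omega)
  induction k using Nat.twoStepInduction with
  | zero =>
    rw [hbase]
    exact mul_nonneg (by norm_num) ((rootCount_evenLogConcave d hm0 0).nonneg 0)
  | one =>
    have hg := rootCount_evenLogConcave d hm0 0
    have h := hg.windowSum_pow_succ_le hd hm0 le_rfl zero_le_one (by rw [hbase, zero_mul])
    have := (rootCount_evenLogConcave d hm0 1).nonneg 0
    change rootCount d m 1 (m + 1) ≤ _ * rootCount d m 1 0 at h
    linarith
  | more k h0 h1 =>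
    have hg := rootCount_evenLogConcave d hm0 k
    have hg1 := rootCount_evenLogConcave d hm0 (k + 1)
    have hpos := (rootCount_evenLogConcave d hm0 (k + 2)).pos
    by_cases c0 : rootCount d m k (m + 1) ≤ 89 / 100 * rootCount d m k 0
    · have a := hg.windowSum_pow_succ_le hd hm0 (by norm_num) (by norm_num) c0
      have b := hg1.windowSum_pow_succ_le hd hm0 (by norm_num) (by norm_num) a
      change rootCount d m (k + 2) (m + 1) ≤ _ * rootCount d m (k + 2) 0 at b
      linarith
    by_cases c1 : rootCount d m (k + 1) (m + 1) ≤ 89 / 100 * rootCount d m (k + 1) 0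
    · have b := hg1.windowSum_pow_succ_le hd hm0 (by norm_num) (by norm_num) c1
      change rootCount d m (k + 2) (m + 1) ≤ _ * rootCount d m (k + 2) 0 at b
      linarith
    push Not at c0 c1
    exact hg1.windowSum_pow_succ_le_of_middle (j := (m + 1) / 2) hd (by omega) (by omega) h1
      c1.le (hg.windowSum_pow_middle_le hd (by omega) (by omega) (by omega) h0 c0.le)

theorem rootCount_le {d : ℕ} {m : ℤ} (hd : 2 ≤ d) (hm : 1 ≤ m) (n : ℕ) :
    ∀ (k : ℕ) (a : ℤ), (n + 1) * m + 1 ≤ a →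
      rootCount d m k a ≤ (9 / 10) ^ d ^ n * rootCount d m k 0 := by
  have hm0 : 0 ≤ m := by omega
  induction n with
  | zero =>
    intro k a ha
    have h := (rootCount_evenLogConcave d hm0 k).antitone (x := m + 1) (y := a) (by omega)
      (by simpa using ha)
    simpa using h.trans (rootCount_succ_le hd hm k)
  | succ n ih =>
    intro k a ha
    have hna : (n + 1 : ℤ) * m + 1 ≤ a - m := by push_cast at ha; linarith
    have ham : 0 ≤ a - m := le_trans (by positivity) hna
    cases k with
    | zero =>
      have : rootCount d m 0 a = 0 := if_neg (by omega)
      rw [this]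
      exact mul_nonneg (by positivity) ((rootCount_evenLogConcave d hm0 0).nonneg 0)
    | succ k =>
      have hg := rootCount_evenLogConcave d hm0 k
      have h := hg.windowSum_add_le hm0 ham (by positivity) (ih k (a - m) hna)
      rw [sub_add_cancel] at h
      have h' := pow_le_pow_left₀ ((hg.windowSum hm0).nonneg a) h d
      rw [mul_pow, ← pow_mul, ← pow_succ] at h'
      exact h'

/-- The elements of `LM d k M` with root value `t`. -/
abbrev RootFiber (d k M : ℕ) (t : ℤ) : Type :=
  {f : Vtx d k → ℤ // f ∈ LM d k M ∧ f (rootV d k) = t}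

/-- The vertex of the tree of depth `k + 1` that corresponds to the vertex `v` of the subtree
rooted at the `j`-th child of the root. -/
def childVtx {d k : ℕ} (j : Fin d) (v : Vtx d k) : Vtx d (k + 1) :=
  ⟨j :: v.1, Nat.succ_le_succ v.2⟩

/-- Glue functions on the subtrees of the root to a function with root value `t`. -/
def graft {d k : ℕ} (t : ℤ) (F : Fin d → Vtx d k → ℤ) : Vtx d (k + 1) → ℤ
  | ⟨[], _⟩ => t
  | ⟨j :: l, h⟩ => F j ⟨l, Nat.le_of_succ_le_succ h⟩

theorem graft_mem_LM {d k M : ℕ} {t : ℤ} {F : Fin d → Vtx d k → ℤ}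
    (hF : ∀ j, F j ∈ LM d k M) (ht : ∀ j, |F j (rootV d k) - t| ≤ M) :
    graft t F ∈ LM d (k + 1) M := by
  constructor
  · rintro ⟨_ | ⟨j, l⟩, h⟩ hv
    · simp at hv
    · exact (hF j).1 ⟨l, _⟩ (by simpa using hv)
  · rintro (_ | ⟨i, l⟩) hl j
    · exact ht j
    · exact (hF i).2 l (Nat.le_of_succ_le_succ hl) j

theorem comp_childVtx_mem_LM {d k M : ℕ} {f : Vtx d (k + 1) → ℤ} (hf : f ∈ LM d (k + 1) M)
    (j : Fin d) : (fun v => f (childVtx j v)) ∈ LM d k M :=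
  ⟨fun v hv => hf.1 _ (by simp [childVtx, hv]),
    fun l hl i => hf.2 (j :: l) (Nat.succ_le_succ hl) i⟩

theorem rootFiber_sigma_ext {d k M : ℕ} {S : Finset ℤ} {p q : Σ s : S, RootFiber d k M s}
    (h : p.2.1 = q.2.1) : p = q := by
  obtain ⟨⟨s, hs⟩, f, hf, hr⟩ := p
  obtain ⟨⟨s', hs'⟩, f', hf', hr'⟩ := q
  change f = f' at h
  change f (rootV d k) = s at hr
  change f' (rootV d k) = s' at hr'
  subst h hr hr'
  rfl

/-- A Lipschitz function with root value `t` amounts to a choice, for every child of the root,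
of a Lipschitz function on its subtree with root value within `M` of `t`. -/
def rootFiberSuccEquiv (d k M : ℕ) (t : ℤ) :
    RootFiber d (k + 1) M t ≃
      (Fin d → Σ s : Finset.Icc (t - (M : ℤ)) (t + M), RootFiber d k M s) where
  toFun f j := ⟨⟨f.1 (childVtx j (rootV d k)), by
      have h := f.2.1.2 [] (Nat.succ_le_succ (Nat.zero_le k)) j
      have e : f.1 ⟨[], Nat.zero_le _⟩ = t := f.2.2
      rw [e, abs_le] at h
      rw [Finset.mem_Icc]
      change t - M ≤ f.1 ⟨[] ++ [j], _⟩ ∧ f.1 ⟨[] ++ [j], _⟩ ≤ t + M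
      constructor <;> linarith [h.1, h.2]⟩,
    ⟨fun v => f.1 (childVtx j v), comp_childVtx_mem_LM f.2.1 j, rfl⟩⟩
  invFun F := ⟨graft t fun j => (F j).2.1, graft_mem_LM (fun j => (F j).2.2.1) fun j => by
      rw [(F j).2.2.2, abs_le]
      have := Finset.mem_Icc.1 (F j).1.2
      constructor <;> linarith [this.1, this.2], rfl⟩
  left_inv := by
    rintro ⟨f, hf, hr⟩
    ext ⟨_ | ⟨j, l⟩, h⟩
    · exact hr.symm
    · rfl
  right_inv F := by
    funext j
    exact rootFiber_sigma_ext rfl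

theorem rootFiber_zero_eq (d M : ℕ) (t : ℤ) (f : RootFiber d 0 M t) (v : Vtx d 0) : f.1 v = 0 :=
  f.2.1.1 v (Nat.le_zero.1 v.2)

instance rootFiber_finite (d k M : ℕ) (t : ℤ) : Finite (RootFiber d k M t) := by
  induction k generalizing t with
  | zero =>
    have : Subsingleton (RootFiber d 0 M t) := ⟨fun f g => Subtype.ext <| funext fun v => by
      rw [rootFiber_zero_eq, rootFiber_zero_eq]⟩
    infer_instance
  | succ k ih => exact Finite.of_equiv _ (rootFiberSuccEquiv d k M t).symm

theorem G_zero (d M : ℕ) (t : ℤ) : G d 0 M t = if t = 0 then 1 else 0 := by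
  split_ifs with ht
  · subst ht
    refine Nat.card_eq_one_iff_unique.2 ⟨⟨fun f g => Subtype.ext <| funext fun v => ?_⟩,
      ⟨⟨fun _ => 0, ⟨fun _ _ => rfl, fun l hl => absurd hl (by omega)⟩, rfl⟩⟩⟩
    rw [rootFiber_zero_eq, rootFiber_zero_eq]
  · have : IsEmpty (RootFiber d 0 M t) :=
      ⟨fun f => ht (f.2.2.symm.trans (rootFiber_zero_eq d M t f _))⟩
    exact Nat.card_of_isEmpty

theorem G_succ (d k M : ℕ) (t : ℤ) :
    G d (k + 1) M t = (∑ s ∈ Finset.Icc (t - (M : ℤ)) (t + M), G d k M s) ^ d := by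
  unfold G
  rw [Nat.card_congr (rootFiberSuccEquiv d k M t), Nat.card_fun, Nat.card_sigma, Nat.card_fin,
    Finset.sum_coe_sort _ fun s => Nat.card (RootFiber d k M s)]

theorem G_eq_rootCount (d k M : ℕ) (t : ℤ) : (G d k M t : ℝ) = rootCount d M k t := by
  induction k generalizing t with
  | zero => rw [G_zero]; simp [rootCount]
  | succ k ih => rw [G_succ]; simp [rootCount, windowSum, ih]

/-- **Theorem.**  Let `d ≥ 2` and `M, k ≥ 1`.  If `f` is chosen uniformly at random
from `L_M(d,k)`, then for every integer `t ≥ 1`,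
`Pr(f(v₀) = M + t) ≤ (9/10) ^ (d ^ ⌊(t-1)/M⌋) * Pr(f(v₀) = 0)`. -/
theorem lipschitz_tree_root_upper_tail (d M k : ℕ) (hd : 2 ≤ d) (hM : 1 ≤ M)
    (hk : 1 ≤ k) (t : ℤ) (ht : 1 ≤ t) :
    PrRoot d k M ((M : ℤ) + t) ≤
      (9 / 10 : ℝ) ^ (d ^ ((t - 1) / (M : ℤ)).toNat) * PrRoot d k M 0 := by
  have hM' : (1 : ℤ) ≤ M := by exact_mod_cast hM
  have hdiv : (((t - 1) / (M : ℤ)).toNat : ℤ) = (t - 1) / M :=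
    Int.toNat_of_nonneg (Int.ediv_nonneg (by omega) (by omega))
  have hmul := Int.ediv_mul_le (t - 1) (by omega : (M : ℤ) ≠ 0)
  have h := rootCount_le hd hM' ((t - 1) / (M : ℤ)).toNat k (M + t) (by rw [hdiv]; linarith)
  rw [← G_eq_rootCount, ← G_eq_rootCount] at h
  unfold PrRoot
  rw [← mul_div_assoc]
  exact div_le_div_of_nonneg_right h (Nat.cast_nonneg _)
end

section
/- Let d ≥ 2 and M, k ≥ 1 be integers, and let f be chosen uniformly at random from L_M(d,k). Then Pr(f(v_0) = 0) ≤ 1/(1 + 2^(1-d)·M). -/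
/-- Replace the root value by `t` and negate the function on the subtrees below those
children `j` of the root for which `b j` holds. -/
def reflectBranches {d k : ℕ} (b : Fin d → Bool) (t : ℤ) (f : Vtx d k → ℤ) : Vtx d k → ℤ
  | ⟨[], _⟩ => t
  | ⟨j :: l, h⟩ => if b j then -f ⟨j :: l, h⟩ else f ⟨j :: l, h⟩

theorem reflectBranches_reflectBranches {d k : ℕ} (b : Fin d → Bool) (s t : ℤ)
    (f : Vtx d k → ℤ) (hf : f (rootV d k) = s) :
    reflectBranches b s (reflectBranches b t f) = f := by
  funext ⟨l, hl⟩
  cases l with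
  | nil => exact hf.symm
  | cons j l => cases h : b j <;> simp [reflectBranches, h]

/-- Reflecting branches keeps a function in `L_M(d,k)` as soon as the new values at the
children of the root are compatible with the new root value. -/
theorem reflectBranches_mem_LM {d k M : ℕ} (hk : 1 ≤ k) (b : Fin d → Bool) (t : ℤ)
    {f : Vtx d k → ℤ} (hf : f ∈ LM d k M)
    (hb : ∀ j : Fin d,
      |(if b j then -f ⟨[j], by simpa using hk⟩ else f ⟨[j], by simpa using hk⟩) - t| ≤ (M : ℤ)) :
    reflectBranches b t f ∈ LM d k M := by
  obtain ⟨hleaf, hlip⟩ := hf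
  refine ⟨?_, ?_⟩
  · rintro ⟨l, hl⟩ hlen
    cases l with
    | nil => simp at hlen; omega
    | cons j l => simp [reflectBranches, hleaf ⟨j :: l, hl⟩ hlen]
  · intro l hl j
    cases l with
    | nil => exact hb j
    | cons a l =>
      have h := hlip (a :: l) hl j
      simp only [List.cons_append] at h
      simp only [List.cons_append, reflectBranches]
      split_ifs
      · rwa [neg_sub_neg, abs_sub_comm]
      · exact h

/-- For `|t| ≤ M`, the value `0` at the root is at most `2 ^ d` times as frequent as `t`. -/
theorem G_zero_le_two_pow_mul_G {d k M : ℕ} [Finite (LM d k M)] (hk : 1 ≤ k) {t : ℤ}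
    (ht : |t| ≤ (M : ℤ)) : G d k M 0 ≤ 2 ^ d * G d k M t := by
  have : Finite {f : Vtx d k → ℤ // f ∈ LM d k M ∧ f (rootV d k) = t} :=
    Set.Finite.subset (Set.toFinite (LM d k M)) fun _ hf => hf.1
  let b (f : Vtx d k → ℤ) (j : Fin d) : Bool := (M : ℤ) < |f ⟨[j], by simpa using hk⟩ - t|
  have hmem (f : {f : Vtx d k → ℤ // f ∈ LM d k M ∧ f (rootV d k) = 0}) :
      reflectBranches (b f.1) t f.1 ∈ LM d k M := by
    obtain ⟨f, hf, h0⟩ := f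
    refine reflectBranches_mem_LM hk _ t hf fun j => ?_
    have hj : |f ⟨[j], by simpa using hk⟩ - f (rootV d k)| ≤ (M : ℤ) :=
      hf.2 [] (by simpa using hk) j
    rw [h0, sub_zero] at hj
    simp only [b, decide_eq_true_eq]
    split_ifs <;> grind
  let φ (f : {f : Vtx d k → ℤ // f ∈ LM d k M ∧ f (rootV d k) = 0}) :
      (Fin d → Bool) × {f : Vtx d k → ℤ // f ∈ LM d k M ∧ f (rootV d k) = t} :=
    (b f.1, ⟨reflectBranches (b f.1) t f.1, hmem f, rfl⟩)
  have hφ : Function.Injective φ := by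
    intro f g hfg
    obtain ⟨hb, hr⟩ := Prod.ext_iff.mp hfg
    have hr : reflectBranches (b f.1) t f.1 = reflectBranches (b g.1) t g.1 :=
      congrArg Subtype.val hr
    have hb : b f.1 = b g.1 := hb
    apply Subtype.ext
    rw [← reflectBranches_reflectBranches (b f.1) 0 t f.1 f.2.2, hr, hb,
      reflectBranches_reflectBranches (b g.1) 0 t g.1 g.2.2]
  have hcard := Nat.card_le_card_of_injective φ hφ
  rw [Nat.card_prod] at hcard
  simpa [G] using hcard

theorem sum_G_le_card_LM {d k M : ℕ} [Finite (LM d k M)] (s : Finset ℤ) :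
    ∑ t ∈ s, G d k M t ≤ Nat.card (LM d k M) := by
  have (t : ℤ) : Finite {f : Vtx d k → ℤ // f ∈ LM d k M ∧ f (rootV d k) = t} :=
    Set.Finite.subset (Set.toFinite (LM d k M)) fun _ hf => hf.1
  let φ (p : Σ t : s, {f : Vtx d k → ℤ // f ∈ LM d k M ∧ f (rootV d k) = t}) : LM d k M :=
    ⟨p.2.1, p.2.2.1⟩
  have hφ : Function.Injective φ := by
    rintro ⟨⟨t, ht⟩, f, hf, hft⟩ ⟨⟨u, hu⟩, g, hg, hgu⟩ h
    obtain rfl : f = g := congrArg Subtype.val h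
    obtain rfl : t = u := hft.symm.trans hgu
    rfl
  have hcard := Nat.card_le_card_of_injective φ hφ
  rw [Nat.card_sigma] at hcard
  rw [← Finset.sum_coe_sort]
  exact hcard

/-- The root value `0` and the `2 * M` nonzero root values in `[-M, M]` together bound the
size of `L_M(d,k)` from below in terms of `G 0`. -/
theorem G_zero_mul_le_card_LM {d k M : ℕ} [Finite (LM d k M)] (hk : 1 ≤ k) :
    (2 ^ d + 2 * M) * G d k M 0 ≤ 2 ^ d * Nat.card (LM d k M) := by
  set s := (Finset.Icc (-(M : ℤ)) M).erase 0
  have hs : s.card = 2 * M := by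
    rw [Finset.card_erase_of_mem (by simp), Int.card_Icc]
    omega
  calc (2 ^ d + 2 * M) * G d k M 0
      = 2 ^ d * G d k M 0 + ∑ _t ∈ s, G d k M 0 := by
        rw [Finset.sum_const, hs, smul_eq_mul, add_mul]
    _ ≤ 2 ^ d * G d k M 0 + ∑ t ∈ s, 2 ^ d * G d k M t := by
        gcongr with t ht
        exact G_zero_le_two_pow_mul_G hk
          (abs_le.mpr (Finset.mem_Icc.mp (Finset.mem_of_mem_erase ht)))
    _ = 2 ^ d * ∑ t ∈ Finset.Icc (-(M : ℤ)) M, G d k M t := by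
        rw [← Finset.mul_sum, ← mul_add, Finset.add_sum_erase _ _ (by simp)]
    _ ≤ 2 ^ d * Nat.card (LM d k M) := by
        gcongr
        exact sum_G_le_card_LM _

/-- **Theorem.**  Let `d ≥ 2` and `M, k ≥ 1`.  If `f` is chosen uniformly at random
from `L_M(d,k)`, then `Pr(f(v₀) = 0) ≤ 1 / (1 + 2^(1-d) * M)`. -/
theorem lipschitz_tree_root_zero_upper (d M k : ℕ) (hd : 2 ≤ d) (hM : 1 ≤ M)
    (hk : 1 ≤ k) :
    PrRoot d k M 0 ≤ 1 / (1 + (2 : ℝ) ^ ((1 : ℤ) - (d : ℤ)) * (M : ℝ)) := by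
  rcases finite_or_infinite (LM d k M) with hfin | hinf
  · have hne : Nonempty (LM d k M) := ⟨⟨0, by simp [LM]⟩⟩
    have hpos : (0 : ℝ) < Nat.card (LM d k M) := by exact_mod_cast Nat.card_pos
    have hcard : ((2 : ℝ) ^ d + 2 * M) * G d k M 0 ≤ 2 ^ d * Nat.card (LM d k M) := by
      exact_mod_cast G_zero_mul_le_card_LM (d := d) (M := M) hk
    have hpow : (2 : ℝ) ^ ((1 : ℤ) - (d : ℤ)) = 2 / 2 ^ d := by
      rw [zpow_sub₀ two_ne_zero, zpow_one, zpow_natCast]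
    rw [PrRoot, hpow, div_le_div_iff₀ hpos (by positivity), one_mul]
    have hd0 : (0 : ℝ) < 2 ^ d := by positivity
    refine le_of_mul_le_mul_left ?_ hd0
    calc (2 : ℝ) ^ d * (G d k M 0 * (1 + 2 / 2 ^ d * M))
        = (2 ^ d + 2 * M) * G d k M 0 := by field_simp
      _ ≤ 2 ^ d * Nat.card (LM d k M) := hcard
  · rw [PrRoot, Nat.card_eq_zero_of_infinite, Nat.cast_zero, div_zero]
    positivity
end
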